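/- For every integer i ≥ 1 and every real number t ≠ 0, the i-th derivative at t of the function g(t) = 1/(1 - e^{-t}) equals ∑_{m=1}^{i+1} λ_{i,m}/(e^t - 1)^m, where λ_{i,m} = (-1)^i · (m-1)! · S(i+1, m). -/

import Mathlib

/-- The Stirling numbers of the second kind, via the explicit formula. -/
def S (n m : ℕ) : ℚ :=
  (1 / (m.factorial : ℚ)) *
    ∑ ℓ ∈ Finset.range (m + 1), (-1 : ℚ) ^ (m - ℓ) * (m.choose ℓ : ℚ) * (ℓ : ℚ) ^ n

/-- The coefficients `λ_{i,m} = (-1)^i (m-1)! S(i+1, m)`. -/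
def lam (i m : ℕ) : ℚ := (-1 : ℚ) ^ i * ((m - 1).factorial : ℚ) * S (i + 1) m

theorem S_succ_succ (n m : ℕ) : S (n+1) (m+1) = (m+1) * S n (m+1) + S n m := by
  have key : ∑ ℓ ∈ Finset.range (m + 1 + 1), (-1 : ℚ) ^ (m + 1 - ℓ) * ((m+1).choose ℓ : ℚ) * (ℓ : ℚ) ^ (n+1)
      = (m+1) * (∑ ℓ ∈ Finset.range (m + 1 + 1), (-1 : ℚ) ^ (m + 1 - ℓ) * ((m+1).choose ℓ : ℚ) * (ℓ : ℚ) ^ n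
        + ∑ ℓ ∈ Finset.range (m + 1), (-1 : ℚ) ^ (m - ℓ) * (m.choose ℓ : ℚ) * (ℓ : ℚ) ^ n) := by
    rw [Finset.sum_range_succ, Finset.sum_range_succ _ (m+1), add_right_comm,
      ← Finset.sum_add_distrib, mul_add, Finset.mul_sum]
    congr 1
    · apply Finset.sum_congr rfl
      intro l hl
      have hl' : l ≤ m := by have := Finset.mem_range.1 hl; omega
      have h1 : m + 1 - l = (m - l) + 1 := by omega
      have h2 : ((m+1).choose l : ℚ) * l = (m+1) * ((m+1).choose l - m.choose l) := by
        have h := Nat.choose_mul_succ_eq m l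
        have h' : (m.choose l : ℚ) * (m+1) = (m+1).choose l * ((m:ℚ)+1-l) := by
          have h3 : ((m + 1 - l : ℕ) : ℚ) = (m:ℚ)+1-l := by
            rw [Nat.cast_sub (by omega)]; push_cast; ring
          rw [← h3]; exact_mod_cast h
        linear_combination h'
      rw [h1, pow_succ, pow_succ]
      linear_combination (-(-1 : ℚ) ^ (m - l) * (l:ℚ)^n) * h2
    · simp; ring
  unfold S
  rw [key, Nat.factorial_succ]
  have : (m.factorial : ℚ) ≠ 0 := by exact_mod_cast m.factorial_ne_zero
  have h2 : (m : ℚ) + 1 ≠ 0 := by positivity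
  push_cast
  field_simp

theorem S_eq (n m : ℕ) : S n m = (n.stirlingSecond m : ℚ) := by
  induction n generalizing m with
  | zero =>
    cases m with
    | zero => simp [S]
    | succ m =>
      have := add_pow (1:ℚ) (-1) (m+1)
      simp at this
      simp [S, ← this]
  | succ n ih =>
    cases m with
    | zero => simp [S]
    | succ m => rw [S_succ_succ, ih, ih, Nat.stirlingSecond_succ_succ]; push_cast; ring

/-- closed form -/
noncomputable def FF (i : ℕ) (x : ℝ) : ℝ :=
  ∑ k ∈ Finset.range (i+1), ((-1)^i * k.factorial * (i+1).stirlingSecond (k+1) : ℝ) * x^(k+1)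

theorem FF_step (i : ℕ) (x : ℝ) :
    ∑ k ∈ Finset.range (i+1), ((-1)^i * k.factorial * (i+1).stirlingSecond (k+1) : ℝ) *
      ((k+1) * x^k * (-(x+x^2))) = FF (i+1) x := by
  unfold FF
  have h : ∀ k : ℕ, ((-1)^(i+1) * k.factorial * (i+1+1).stirlingSecond (k+1) : ℝ) * x^(k+1)
    = ((-1)^(i+1) * k.factorial * ((k+1) * (i+1).stirlingSecond (k+1)) : ℝ) * x^(k+1)
      + ((-1)^(i+1) * k.factorial * ((i+1).stirlingSecond k) : ℝ) * x^(k+1) := by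
    intro k
    rw [Nat.stirlingSecond_succ_succ]; push_cast; ring
  simp_rw [h]
  rw [Finset.sum_add_distrib, Finset.sum_range_succ _ (i+1), Finset.sum_range_succ' _ (i+1),
    Nat.stirlingSecond_eq_zero_of_lt (show i+1 < i+1+1 by omega), Nat.stirlingSecond_succ_zero]
  simp only [Nat.cast_zero, mul_zero, zero_mul, add_zero]
  rw [← Finset.sum_add_distrib]
  apply Finset.sum_congr rfl
  intro k _
  rw [Nat.factorial_succ]; push_cast; ring

theorem exp_sub_ne {t : ℝ} (ht : t ≠ 0) : Real.exp t - 1 ≠ 0 := by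
  intro h
  exact ht (by simpa using (sub_eq_zero.1 h))

theorem hasDeriv_FF (i : ℕ) (t : ℝ) (ht : t ≠ 0) :
    HasDerivAt (fun s => FF i ((Real.exp s - 1)⁻¹)) (FF (i+1) ((Real.exp t - 1)⁻¹)) t := by
  have h0 := exp_sub_ne ht
  have hx : HasDerivAt (fun s => (Real.exp s - 1)⁻¹)
      (-((Real.exp t - 1)⁻¹ + (Real.exp t - 1)⁻¹^2)) t := by
    have he : -((Real.exp t - 1)⁻¹ + (Real.exp t - 1)⁻¹ ^ 2)
        = -Real.exp t / (Real.exp t - 1) ^ 2 := by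
      field_simp
      ring
    rw [he]
    exact ((Real.hasDerivAt_exp t).sub_const 1).fun_inv h0
  rw [← FF_step]
  unfold FF
  apply HasDerivAt.fun_sum
  intro k _
  have := (hx.fun_pow (k+1)).const_mul ((-1)^i * k.factorial * (i+1).stirlingSecond (k+1) : ℝ)
  simpa using this

theorem iter_eq (i : ℕ) : ∀ t : ℝ, t ≠ 0 →
    iteratedDeriv i (fun s : ℝ => 1 / (1 - Real.exp (-s))) t = 0^i + FF i ((Real.exp t - 1)⁻¹) := by
  induction i with
  | zero =>
    intro t ht
    have h0 := exp_sub_ne ht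
    have h1 : 1 - Real.exp (-t) = (Real.exp t - 1) / Real.exp t := by
      rw [Real.exp_neg]; field_simp
    simp only [iteratedDeriv_zero, FF, h1]
    simp [Nat.stirlingSecond]
    field_simp
    ring
  | succ i ih =>
    intro t ht
    rw [iteratedDeriv_succ]
    have : iteratedDeriv i (fun s : ℝ => 1 / (1 - Real.exp (-s))) =ᶠ[nhds t]
        fun s => 0^i + FF i ((Real.exp s - 1)⁻¹) := by
      filter_upwards [isOpen_ne.mem_nhds ht] with s hs using ih s hs
    rw [this.deriv_eq, ((hasDeriv_FF i t ht).const_add _).deriv]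
    simp

theorem iteratedDeriv_one_div_one_sub_exp_neg (i : ℕ) (hi : 1 ≤ i) (t : ℝ) (ht : t ≠ 0) :
    iteratedDeriv i (fun s : ℝ => 1 / (1 - Real.exp (-s))) t =
      ∑ m ∈ Finset.Icc 1 (i + 1), (lam i m : ℝ) / (Real.exp t - 1) ^ m := by
  have h : Finset.Icc 1 (i+1) = Finset.Ico (0+1) (i+1+1) := by
    ext; simp only [Finset.mem_Icc, Finset.mem_Ico]; omega
  rw [iter_eq i t ht, zero_pow (by omega), zero_add, FF, Finset.range_eq_Ico, h,
    ← Finset.sum_Ico_add']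
  apply Finset.sum_congr rfl
  intro k _
  simp [lam, S_eq, div_eq_mul_inv]
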